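/- Every densely defined closed right linear operator T in a quaternionic Hilbert space admits a polar decomposition: there exists a partial isometry U₀ with initial space N(T)^⊥ and final space the closure of R(T) such that T = U₀|T|; moreover U₀ is unique subject to N(U₀) = N(T). -/

import Mathlib

noncomputable section

open MulOpposite

local notation "ℍ" => Quaternion ℝ

variable {H : Type*} [NormedAddCommGroup H] [Module ℍᵐᵒᵖ H]

/-- The axioms of a quaternion-valued inner product compatible with the norm on a
right quaternionic module `H` (scalars act on the right via `ℍᵐᵒᵖ`). -/
structure QInner (inn : H → H → ℍ) : Prop where
  add_right : ∀ u v w : H, inn u (v + w) = inn u v + inn u w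
  smul_right : ∀ (u v : H) (q : ℍ), inn u (op q • v) = inn u v * q
  conj_symm : ∀ u v : H, inn u v = star (inn v u)
  norm_sq : ∀ u : H, inn u u = ((‖u‖ ^ 2 : ℝ) : ℍ)

/-- `B` is the adjoint of the bounded right linear operator `A`. -/
def IsAdjB (inn : H → H → ℍ) (A B : H →L[ℍᵐᵒᵖ] H) : Prop :=
  ∀ x y : H, inn (B x) y = inn x (A y)

/-- `A` is a positive bounded operator. -/
def IsPosB (inn : H → H → ℍ) (A : H →L[ℍᵐᵒᵖ] H) : Prop :=
  IsAdjB inn A A ∧ ∀ x : H, ∃ r : ℝ, 0 ≤ r ∧ inn x (A x) = (r : ℍ)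

/-- Orthogonal complement of a set. -/
def qOrth (inn : H → H → ℍ) (S : Set H) : Set H := {x | ∀ y ∈ S, inn y x = 0}

/-- Null space of a bounded operator. -/
def kerB (A : H →L[ℍᵐᵒᵖ] H) : Set H := {x | A x = 0}

/-- `U` is a partial isometry: it is isometric on `N(U)^⊥`. -/
def IsPartialIsomB (inn : H → H → ℍ) (U : H →L[ℍᵐᵒᵖ] H) : Prop :=
  ∀ x ∈ qOrth inn (kerB U), ‖U x‖ = ‖x‖

/-- Null space of an unbounded operator. -/
def pKer (T : H →ₗ.[ℍᵐᵒᵖ] H) : Set H := {x | ∃ hx : x ∈ T.domain, T ⟨x, hx⟩ = 0}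

/-- Range of an unbounded operator. -/
def pRan (T : H →ₗ.[ℍᵐᵒᵖ] H) : Set H := Set.range fun x : T.domain => T x

/-- `S` is the adjoint of the densely defined operator `T` : the formal adjoint
identity holds and the domain of `S` is maximal. -/
def IsAdjP (inn : H → H → ℍ) (T S : H →ₗ.[ℍᵐᵒᵖ] H) : Prop :=
  (∀ (x : S.domain) (y : T.domain), inn (x : H) (T y) = inn (S x) (y : H)) ∧
  ∀ x z : H, (∀ y : T.domain, inn x (T y) = inn z (y : H)) → x ∈ S.domain

/-- `T` is a positive (self-adjoint) unbounded operator. -/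
def IsPosP (inn : H → H → ℍ) (T : H →ₗ.[ℍᵐᵒᵖ] H) : Prop :=
  IsAdjP inn T T ∧ ∀ x : T.domain, ∃ r : ℝ, 0 ≤ r ∧ inn (x : H) (T x) = (r : ℍ)

/-- `C = S ∘ T` as unbounded operators, with the usual maximal domain. -/
def IsCompP (S T C : H →ₗ.[ℍᵐᵒᵖ] H) : Prop :=
  (∀ x : H, x ∈ C.domain ↔ ∃ hx : x ∈ T.domain, T ⟨x, hx⟩ ∈ S.domain) ∧
  ∀ (x : C.domain) (hx : (x : H) ∈ T.domain) (h2 : T ⟨x, hx⟩ ∈ S.domain),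
    C x = S ⟨T ⟨x, hx⟩, h2⟩

/-- `T = U ∘ P` where `U` is bounded and `T`, `P` are unbounded. -/
def EqCompB (T : H →ₗ.[ℍᵐᵒᵖ] H) (U : H →L[ℍᵐᵒᵖ] H) (P : H →ₗ.[ℍᵐᵒᵖ] H) : Prop :=
  T.domain = P.domain ∧
  ∀ (x : H) (hx : x ∈ T.domain) (hx' : x ∈ P.domain), T ⟨x, hx⟩ = U (P ⟨x, hx'⟩)

/-- The bounded operator `B` commutes with the unbounded operator `T`, i.e. `TB ⊆ BT`. -/
def CommP (B : H →L[ℍᵐᵒᵖ] H) (T : H →ₗ.[ℍᵐᵒᵖ] H) : Prop :=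
  ∀ x : T.domain, ∃ h : B (x : H) ∈ T.domain, T ⟨B (x : H), h⟩ = B (T x)



set_option linter.unusedSectionVars false

/-! ### Real Hilbert space machinery -/

section RealPart

variable {R E : Type*} [NormedDivisionRing R] [Algebra ℝ R] [NormedAddCommGroup E]
  [InnerProductSpace ℝ E] [Module R E] [IsScalarTower ℝ R E]

/-- Adjoint relation with respect to the real inner product. -/
def RAdj (T S : E →ₗ.[R] E) : Prop :=
  (∀ (x : S.domain) (y : T.domain), inner ℝ (x : E) (T y) = inner ℝ (S x) (y : E)) ∧
  ∀ x z : E, (∀ y : T.domain, inner ℝ x (T y) = inner ℝ z (y : E)) → x ∈ S.domain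

/-- The graph as a real subspace of the `L2` product. -/
def graphL2 (S : E →ₗ.[R] E) : Submodule ℝ (WithLp 2 (E × E)) :=
  (S.graph.restrictScalars ℝ).comap (WithLp.linearEquiv 2 ℝ (E × E)).toLinearMap

lemma mem_graphL2 (S : E →ₗ.[R] E) (p : WithLp 2 (E × E)) :
    p ∈ graphL2 S ↔ ∃ x : S.domain, p = WithLp.toLp 2 ((x : E), S x) := by
  simp only [graphL2, Submodule.mem_comap, Submodule.restrictScalars_mem]
  rw [LinearPMap.mem_graph_iff']
  constructor
  · rintro ⟨y, hy⟩
    refine ⟨y, ?_⟩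
    rw [hy]
    rfl
  · rintro ⟨y, rfl⟩
    exact ⟨y, rfl⟩

lemma isClosed_graphL2 (S : E →ₗ.[R] E) (h : IsClosed (S.graph : Set (E × E))) :
    IsClosed (graphL2 S : Set (WithLp 2 (E × E))) :=
  h.preimage (WithLp.prod_continuous_ofLp 2 E E)

lemma eq_of_inner_dense {p : Submodule R E} (hd : Dense (p : Set E)) {u v : E}
    (h : ∀ y : p, inner ℝ u (y : E) = inner ℝ v (y : E)) : u = v := by
  refine ext_inner_right ℝ fun w => ?_
  have := Continuous.ext_on hd (f := fun w => inner ℝ u w) (g := fun w => inner ℝ v w)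
    (by fun_prop) (by fun_prop) (fun y hy => h ⟨y, hy⟩)
  exact congrFun this w

lemma surj_one_add [CompleteSpace E] (S Ss : E →ₗ.[R] E) (hd : Dense (S.domain : Set E))
    (hc : IsClosed (S.graph : Set (E × E))) (hadj : RAdj S Ss) (h : E) :
    ∃ (x : S.domain) (h2 : S x ∈ Ss.domain), (x : E) + Ss ⟨S x, h2⟩ = h := by
  have hG := isClosed_graphL2 S hc
  have : CompleteSpace (graphL2 S) := hG.completeSpace_coe
  obtain ⟨g, hg, w, hw, hgw⟩ :=
    (graphL2 S).exists_add_mem_mem_orthogonal (WithLp.toLp 2 (h, (0 : E)))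
  obtain ⟨x, rfl⟩ := (mem_graphL2 S g).1 hg
  have hw1 : w = WithLp.toLp 2 (h - (x : E), - S x) := by
    rw [← sub_eq_iff_eq_add'] at hgw
    rw [← hgw, ← WithLp.toLp_sub]
    simp
  subst hw1
  have key : ∀ y : S.domain, inner ℝ (S x) (S y) = inner ℝ (h - (x : E)) (y : E) := by
    intro y
    have := (Submodule.mem_orthogonal' _ _).1 hw _ ((mem_graphL2 S _).2 ⟨y, rfl⟩)
    rw [WithLp.prod_inner_apply] at this
    simp only [inner_neg_left] at this
    linarith
  have h2 := hadj.2 _ _ key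
  refine ⟨x, h2, ?_⟩
  have : Ss ⟨S x, h2⟩ = h - (x : E) := by
    refine eq_of_inner_dense hd fun y => ?_
    rw [← key y, ← hadj.1 ⟨S x, h2⟩ y]
  rw [this]; abel

lemma core_closure [CompleteSpace E] (S Ss : E →ₗ.[R] E) (hd : Dense (S.domain : Set E))
    (hc : IsClosed (S.graph : Set (E × E))) (hadj : RAdj S Ss) (D : Submodule R E)
    (hD : ∀ x : S.domain, S x ∈ Ss.domain → (x : E) ∈ D)
    (y : S.domain) :
    ((y : E), S y) ∈ closure {p : E × E | ∃ x : S.domain, (x : E) ∈ D ∧ p = ((x : E), S x)} := by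
  have hG := isClosed_graphL2 S hc
  set P : Submodule ℝ (WithLp 2 (E × E)) := graphL2 S ⊓
    ((D.restrictScalars ℝ).comap
      ((LinearMap.fst ℝ E E).comp (WithLp.linearEquiv 2 ℝ (E × E)).toLinearMap)) with hP
  have hPmem : ∀ p, p ∈ P ↔ ∃ x : S.domain, (x : E) ∈ D ∧ p = WithLp.toLp 2 ((x : E), S x) := by
    intro p
    rw [hP, Submodule.mem_inf, mem_graphL2]
    constructor
    · rintro ⟨⟨x, rfl⟩, hx⟩
      exact ⟨x, hx, rfl⟩
    · rintro ⟨x, hx, rfl⟩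
      exact ⟨⟨x, rfl⟩, hx⟩
  have hPG : P.topologicalClosure ≤ graphL2 S :=
    P.topologicalClosure_minimal inf_le_left hG
  have : CompleteSpace P.topologicalClosure :=
    P.isClosed_topologicalClosure.completeSpace_coe
  obtain ⟨g, hg, w, hw, hgw⟩ :=
    P.topologicalClosure.exists_add_mem_mem_orthogonal (WithLp.toLp 2 ((y : E), S y))
  have hwG : w ∈ graphL2 S := by
    rw [← sub_eq_iff_eq_add'] at hgw
    rw [← hgw]
    exact Submodule.sub_mem _ ((mem_graphL2 S _).2 ⟨y, rfl⟩) (hPG hg)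
  obtain ⟨z, rfl⟩ := (mem_graphL2 S w).1 hwG
  have hz : z = 0 := by
    obtain ⟨x, h2, hx⟩ := surj_one_add S Ss hd hc hadj (z : E)
    have h0 := (Submodule.mem_orthogonal _ _).1 hw _
      (P.le_topologicalClosure ((hPmem _).2 ⟨x, hD x h2, rfl⟩))
    rw [WithLp.prod_inner_apply] at h0
    simp only at h0
    have h1 := hadj.1 ⟨S x, h2⟩ z
    simp only at h1
    rw [h1, ← inner_add_left, hx] at h0
    exact Subtype.ext (inner_self_eq_zero.1 h0)
  subst hz
  have : WithLp.toLp 2 ((y : E), S y) ∈ closure (P : Set (WithLp 2 (E × E))) := by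
    have hz0 : WithLp.toLp 2 (((0 : S.domain) : E), S 0) = 0 := by
      rw [LinearPMap.map_zero]
      rfl
    rw [hgw, hz0, add_zero]
    exact hg
  have h3 := (image_closure_subset_closure_image (WithLp.prod_continuous_ofLp 2 E E)
    (s := (P : Set (WithLp 2 (E × E))))) ⟨_, this, rfl⟩
  refine closure_mono ?_ h3
  rintro _ ⟨p, hp, rfl⟩
  obtain ⟨x, hx, rfl⟩ := (hPmem p).1 hp
  exact ⟨x, hx, rfl⟩

lemma transfer [CompleteSpace E] (S S' : E →ₗ.[R] E)
    (hc : IsClosed (S'.graph : Set (E × E))) (D : Submodule R E)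
    (hD' : ∀ x ∈ D, x ∈ S'.domain)
    (hn : ∀ (x : S.domain) (x' : S'.domain), (x : E) = x' → (x : E) ∈ D → ‖S' x'‖ = ‖S x‖)
    (y : S.domain)
    (hy : ((y : E), S y) ∈
      closure {p : E × E | ∃ x : S.domain, (x : E) ∈ D ∧ p = ((x : E), S x)}) :
    ∃ h : (y : E) ∈ S'.domain, ‖S' ⟨y, h⟩‖ = ‖S y‖ := by
  obtain ⟨p, hp, hlim⟩ := mem_closure_iff_seq_limit.1 hy
  choose x hxD hx using hp
  let x' : ℕ → S'.domain := fun n => ⟨x n, hD' _ (hxD n)⟩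
  have hp' : p = fun n => (((x n : E)), S (x n)) := funext hx
  rw [hp'] at hlim
  have h1 := (Prod.tendsto_iff _ _).1 hlim
  obtain ⟨ha, hb⟩ := h1
  simp only at ha hb
  have hcs : CauchySeq fun n => S' (x' n) := by
    have h4 := Metric.cauchySeq_iff.1 hb.cauchySeq
    refine Metric.cauchySeq_iff.2 fun ε hε => ?_
    obtain ⟨N, hN⟩ := h4 ε hε
    refine ⟨N, fun m hm n hn' => ?_⟩
    have h5 := hN m hm n hn'
    rw [dist_eq_norm, ← LinearPMap.map_sub] at h5 ⊢
    rw [hn (x m - x n) (x' m - x' n) rfl (D.sub_mem (hxD m) (hxD n))]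
    exact h5
  obtain ⟨z, hz⟩ := cauchySeq_tendsto_of_complete hcs
  have hmem : ((y : E), z) ∈ S'.graph := by
    refine hc.mem_of_tendsto (ha.prodMk_nhds hz) (Filter.Eventually.of_forall fun n => ?_)
    exact S'.mem_graph (x' n)
  obtain ⟨y', hy', rfl⟩ := (LinearPMap.mem_graph_iff _).1 hmem
  simp only at hy'
  have h : (y : E) ∈ S'.domain := hy' ▸ y'.2
  refine ⟨h, ?_⟩
  have : (⟨y, h⟩ : S'.domain) = y' := Subtype.ext hy'.symm
  rw [this]
  refine tendsto_nhds_unique hz.norm ?_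
  refine hb.norm.congr fun n => ?_
  exact (hn (x n) (x' n) rfl (hxD n)).symm

lemma closed_of_selfadj (B : E →ₗ.[R] E) (hd : Dense (B.domain : Set E)) (hB : RAdj B B) :
    IsClosed (B.graph : Set (E × E)) := by
  refine isClosed_of_closure_subset fun p hp => ?_
  have key : ∀ y : B.domain, inner ℝ p.1 (B y) = inner ℝ p.2 (y : E) := by
    intro y
    have hcl : IsClosed {q : E × E | inner ℝ q.1 (B y) = inner ℝ q.2 (y : E)} :=
      isClosed_eq (by fun_prop) (by fun_prop)
    refine closure_minimal ?_ hcl hp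
    intro q hq
    obtain ⟨x, hx⟩ := (LinearPMap.mem_graph_iff' _).1 hq
    rw [← hx]
    exact hB.1 x y
  have h1 := hB.2 _ _ key
  have h2 : B ⟨p.1, h1⟩ = p.2 := by
    refine eq_of_inner_dense hd fun y => ?_
    rw [← key y, ← hB.1 ⟨p.1, h1⟩ y]
  exact (LinearPMap.mem_graph_iff _).2 ⟨⟨p.1, h1⟩, rfl, h2⟩

/-- `D(T) = D(B)` with equal norms, when `T*T = B²`. -/
lemma domains [CompleteSpace E] (T Ts B C : E →ₗ.[R] E) (hd : Dense (T.domain : Set E))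
    (hc : IsClosed (T.graph : Set (E × E))) (hadj : RAdj T Ts) (hB : RAdj B B)
    (h1 : ∀ x : E, x ∈ C.domain ↔ ∃ hx : x ∈ T.domain, T ⟨x, hx⟩ ∈ Ts.domain)
    (h1v : ∀ (x : C.domain) (hx : (x : E) ∈ T.domain) (h2 : T ⟨x, hx⟩ ∈ Ts.domain),
      C x = Ts ⟨T ⟨x, hx⟩, h2⟩)
    (h2 : ∀ x : E, x ∈ C.domain ↔ ∃ hx : x ∈ B.domain, B ⟨x, hx⟩ ∈ B.domain)
    (h2v : ∀ (x : C.domain) (hx : (x : E) ∈ B.domain) (h2 : B ⟨x, hx⟩ ∈ B.domain),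
      C x = B ⟨B ⟨x, hx⟩, h2⟩) :
    Dense (B.domain : Set E) ∧ T.domain = B.domain ∧
      ∀ (x : T.domain) (x' : B.domain), (x : E) = x' → ‖T x‖ = ‖B x'‖ := by
  have coreT := core_closure T Ts hd hc hadj C.domain (fun x hx => (h1 x).2 ⟨x.2, hx⟩)
  have hCd : Dense (C.domain : Set E) := by
    have : (T.domain : Set E) ⊆ closure (C.domain : Set E) := by
      intro y hy
      have h3 := image_closure_subset_closure_image (continuous_fst (X := E) (Y := E))
        ⟨_, coreT ⟨y, hy⟩, rfl⟩
      refine closure_mono ?_ h3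
      rintro _ ⟨p, ⟨x, hx, rfl⟩, rfl⟩
      exact hx
    exact dense_closure.1 (hd.mono this)
  have hBd : Dense (B.domain : Set E) := hCd.mono fun x hx => ((h2 x).1 hx).1
  have hBc := closed_of_selfadj B hBd hB
  have coreB := core_closure B B hBd hBc hB C.domain (fun x hx => (h2 x).2 ⟨x.2, hx⟩)
  have hn : ∀ (x : T.domain) (x' : B.domain), (x : E) = x' → (x : E) ∈ C.domain →
      ‖B x'‖ = ‖T x‖ := by
    intro x x' hxx hxC
    obtain ⟨a1, a2⟩ := (h1 _).1 hxC
    obtain ⟨b1, b2⟩ := (h2 _).1 hxC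
    have e1 := h1v ⟨x, hxC⟩ a1 a2
    have e2 := h2v ⟨x, hxC⟩ b1 b2
    have f1 := hadj.1 ⟨T x, a2⟩ x
    have hx' : x' = ⟨x, b1⟩ := Subtype.ext hxx.symm
    subst hx'
    have f2 := hB.1 ⟨B ⟨x, b1⟩, b2⟩ ⟨x, b1⟩
    have e3 : Ts ⟨T x, a2⟩ = B ⟨B ⟨x, b1⟩, b2⟩ := e1.symm.trans e2
    simp only at f1 f2
    rw [e3, ← f2, real_inner_self_eq_norm_sq, real_inner_self_eq_norm_sq] at f1
    exact ((sq_eq_sq₀ (norm_nonneg _) (norm_nonneg _)).1 f1).symm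
  have tT := fun y => transfer T B hBc C.domain (fun x hx => ((h2 x).1 hx).1) hn y (coreT y)
  have tB := fun y => transfer B T hc C.domain (fun x hx => ((h1 x).1 hx).1)
    (fun x x' h hC => (hn x' x h.symm (h ▸ hC)).symm) y (coreB y)
  refine ⟨hBd, le_antisymm (fun y hy => (tT ⟨y, hy⟩).1) (fun y hy => (tB ⟨y, hy⟩).1), ?_⟩
  intro x x' h
  obtain ⟨a, b⟩ := tT x
  rw [← b]
  congr 2
  exact Subtype.ext h

/-- Real form of the polar decomposition. -/
lemma polar_real [CompleteSpace E] [IsBoundedSMul R E] (T B : E →ₗ.[R] E) (hB : RAdj B B)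
    (hBd : Dense (B.domain : Set E)) (hdom : T.domain = B.domain)
    (hn : ∀ (x : T.domain) (x' : B.domain), (x : E) = x' → ‖T x‖ = ‖B x'‖) :
    ∃ U : E →L[R] E,
      (∀ v, (∀ y, U y = 0 → inner ℝ y v = 0) → ‖U v‖ = ‖v‖) ∧
      (∀ v, U v = 0 ↔ ∃ hv : v ∈ T.domain, T ⟨v, hv⟩ = 0) ∧
      Set.range U = closure (Set.range fun x : T.domain => T x) ∧
      (∀ (x : E) (hx : x ∈ T.domain) (hx' : x ∈ B.domain), T ⟨x, hx⟩ = U (B ⟨x, hx'⟩)) ∧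
      ∀ V : E →L[R] E,
        (∀ (x : E) (hx : x ∈ T.domain) (hx' : x ∈ B.domain), T ⟨x, hx⟩ = V (B ⟨x, hx'⟩)) →
        (∀ v, V v = 0 ↔ ∃ hv : v ∈ T.domain, T ⟨v, hv⟩ = 0) → V = U := by
  let Rb : Submodule ℝ E := (LinearMap.range B.toFun).restrictScalars ℝ
  let N : Submodule R E := (LinearMap.ker B.toFun).map B.domain.subtype
  have hRb : ∀ x : B.domain, B x ∈ Rb := fun x => ⟨x, rfl⟩
  have hN : ∀ v, v ∈ N ↔ ∃ hv : v ∈ B.domain, B ⟨v, hv⟩ = 0 := by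
    intro v
    constructor
    · rintro ⟨x, hx, rfl⟩
      exact ⟨x.2, hx⟩
    · rintro ⟨hv, h⟩
      exact ⟨⟨v, hv⟩, h, rfl⟩
  have hNT : ∀ v, v ∈ N ↔ ∃ hv : v ∈ T.domain, T ⟨v, hv⟩ = 0 := by
    intro v
    rw [hN]
    constructor
    · rintro ⟨hv, h⟩
      refine ⟨hdom ▸ hv, ?_⟩
      rw [← norm_eq_zero, hn _ ⟨v, hv⟩ rfl, h, norm_zero]
    · rintro ⟨hv, h⟩
      refine ⟨hdom ▸ hv, ?_⟩
      rw [← norm_eq_zero, ← hn ⟨v, hv⟩ _ rfl, h, norm_zero]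
  have hNorth : ∀ v, v ∈ N ↔ v ∈ Rbᗮ := by
    intro v
    rw [hN, Submodule.mem_orthogonal']
    constructor
    · rintro ⟨hv, h⟩ _ ⟨x, rfl⟩
      have := hB.1 ⟨v, hv⟩ x
      rw [h, inner_zero_left] at this
      exact this
    · intro h
      have key : ∀ y : B.domain, inner ℝ v (B y) = inner ℝ (0 : E) (y : E) := fun y => by
        rw [h _ (hRb y), inner_zero_left]
      have hv := hB.2 _ _ key
      refine ⟨hv, eq_of_inner_dense hBd fun y => ?_⟩
      rw [← key y, ← hB.1 ⟨v, hv⟩ y]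
  have hdec : ∀ v : E, ∃ k ∈ closure (Rb : Set E), ∃ n ∈ N, v = k + n := by
    intro v
    have : CompleteSpace Rb.topologicalClosure :=
      Rb.isClosed_topologicalClosure.completeSpace_coe
    obtain ⟨k, hk, n, hn', h⟩ := Rb.topologicalClosure.exists_add_mem_mem_orthogonal v
    refine ⟨k, hk, n, (hNorth n).2 ?_, h⟩
    rwa [Submodule.orthogonal_closure] at hn'
  let e : (B.domain × N) →ₗ[R] E := B.toFun.coprod N.subtype
  let f : (B.domain × N) →ₗ[R] E :=
    (T.toFun.comp (Submodule.inclusion hdom.ge)).comp (LinearMap.fst R _ _)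
  have he : ∀ x n, e (x, n) = B x + (n : E) := fun x n => rfl
  have hf : ∀ x n, f (x, n) = T ⟨x, hdom.ge x.2⟩ := fun x n => rfl
  have hdense : DenseRange e := by
    intro v
    obtain ⟨k, hk, n, hn', rfl⟩ := hdec v
    have h3 := image_closure_subset_closure_image (f := fun k : E => k + n) (by fun_prop)
      ⟨k, hk, rfl⟩
    refine closure_mono ?_ h3
    rintro _ ⟨_, ⟨x, rfl⟩, rfl⟩
    exact ⟨(x, ⟨n, hn'⟩), rfl⟩
  have hnorm : ∀ x, ‖f x‖ ≤ 1 * ‖e x‖ := by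
    rintro ⟨x, n⟩
    rw [he, hf, one_mul, hn _ x rfl]
    have h0 : inner ℝ (B x) (n : E) = 0 :=
      (Submodule.mem_orthogonal _ _).1 ((hNorth _).1 n.2) _ (hRb x)
    have := norm_add_sq_eq_norm_sq_add_norm_sq_real h0
    nlinarith [norm_nonneg (B x), norm_nonneg (B x + (n : E)), norm_nonneg (n : E)]
  let U := f.extendOfNorm e
  have hU : ∀ x n, U (B x + ((n : N) : E)) = T ⟨x, hdom.ge x.2⟩ := fun x n =>
    LinearMap.extendOfNorm_eq hdense ⟨1, hnorm⟩ (x, n)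
  have hUB : ∀ x, U (B x) = T ⟨x, hdom.ge x.2⟩ := fun x => by
    simpa using hU x 0
  have hUN : ∀ n ∈ N, U n = 0 := fun n hn' => by
    have := hU 0 ⟨n, hn'⟩
    rw [LinearPMap.map_zero, zero_add] at this
    exact this.trans (LinearPMap.map_zero T)
  have hiso : ∀ k ∈ closure (Rb : Set E), ‖U k‖ = ‖k‖ := by
    intro k hk
    have hcl : IsClosed {k : E | ‖U k‖ = ‖k‖} := isClosed_eq (by fun_prop) (by fun_prop)
    refine closure_minimal ?_ hcl hk
    rintro _ ⟨x, rfl⟩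
    change ‖U (B x)‖ = ‖B x‖
    rw [hUB, hn _ x rfl]
  have hker : ∀ v, U v = 0 ↔ v ∈ N := by
    intro v
    refine ⟨fun h => ?_, hUN v⟩
    obtain ⟨k, hk, n, hn', rfl⟩ := hdec v
    rw [map_add, hUN n hn', add_zero] at h
    have h1 := hiso k hk
    rw [h, norm_zero] at h1
    rw [norm_eq_zero.1 h1.symm, zero_add]
    exact hn'
  refine ⟨U, ?_, fun v => (hker v).trans (hNT v), ?_, ?_, ?_⟩
  · intro v hv
    refine hiso v ?_
    have : v ∈ Rbᗮᗮ := by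
      rw [Submodule.mem_orthogonal]
      exact fun y hy => hv y ((hker y).2 ((hNorth y).2 hy))
    rw [Submodule.orthogonal_orthogonal_eq_closure] at this
    exact this
  · apply Set.Subset.antisymm
    · rintro _ ⟨v, rfl⟩
      obtain ⟨k, hk, n, hn', rfl⟩ := hdec v
      rw [map_add, hUN n hn', add_zero]
      have h3 := image_closure_subset_closure_image U.continuous ⟨k, hk, rfl⟩
      refine closure_mono ?_ h3
      rintro _ ⟨_, ⟨x, rfl⟩, rfl⟩
      exact ⟨_, (hUB x).symm⟩
    · have hcl : IsClosed (U '' closure (Rb : Set E)) := by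
        have hK : IsComplete (closure (Rb : Set E)) := isClosed_closure.isComplete
        have hi : Isometry (fun k : Rb.topologicalClosure => U (k : E)) := by
          refine Isometry.of_dist_eq fun a b => ?_
          rw [dist_eq_norm, ← map_sub, hiso ((a : E) - b) (a - b).2, Subtype.dist_eq, dist_eq_norm]
        have : CompleteSpace Rb.topologicalClosure :=
          Rb.isClosed_topologicalClosure.completeSpace_coe
        have := hi.isClosedEmbedding.isClosed_range
        convert this using 1
        ext z
        constructor
        · rintro ⟨k, hk, rfl⟩
          exact ⟨⟨k, hk⟩, rfl⟩
        · rintro ⟨k, rfl⟩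
          exact ⟨k, k.2, rfl⟩
      refine (closure_minimal ?_ hcl).trans (Set.image_subset_range _ _)
      rintro _ ⟨x, rfl⟩
      exact ⟨B ⟨x, hdom.le x.2⟩, subset_closure (hRb _), hUB _⟩
  · intro x hx hx'
    exact (hUB ⟨x, hx'⟩).symm
  · intro V hV hVk
    ext v
    refine congrFun (hdense.equalizer V.continuous U.continuous ?_) v
    funext ⟨x, n⟩
    simp only [Function.comp, he]
    rw [hU, map_add, (hVk n).2 ((hNT n).1 n.2), add_zero]
    exact (hV x _ x.2).symm

end RealPart

/-! ### From the quaternionic inner product to the real one -/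

section QuatPart

lemma quat_ext {a b : ℍ} (h : ∀ q : ℍ, (a * q).re = (b * q).re) : a = b := by
  have h1 := h (star (a - b))
  have h2 : ((a - b) * star (a - b)).re = 0 := by
    rw [sub_mul, Quaternion.re_sub, h1, sub_self]
  rw [Quaternion.self_mul_star, Quaternion.re_coe, Quaternion.normSq_eq_zero] at h2
  exact sub_eq_zero.1 h2

lemma QInner.norm_smul {inn : H → H → ℍ} (hinn : QInner inn) (q : ℍ) (x : H) :
    ‖op q • x‖ = ‖q‖ * ‖x‖ := by
  have h1 := hinn.norm_sq (op q • x)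
  have h3 : inn (op q • x) x = star q * ((‖x‖ ^ 2 : ℝ) : ℍ) := by
    rw [hinn.conj_symm, hinn.smul_right, star_mul, hinn.norm_sq, Quaternion.star_coe]
  rw [hinn.smul_right, h3, mul_assoc, Quaternion.coe_mul_eq_smul, mul_smul_comm,
    Quaternion.star_mul_self, Quaternion.normSq_eq_norm_mul_self] at h1
  have h4 := congrArg (fun z : ℍ => z.re) h1
  simp only [Quaternion.re_smul, Quaternion.re_coe, smul_eq_mul] at h4
  have : ‖op q • x‖ ^ 2 = (‖q‖ * ‖x‖) ^ 2 := by rw [← h4]; ring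
  exact (sq_eq_sq₀ (norm_nonneg _) (by positivity)).1 this

/-- The opposite quaternions as a normed division ring. -/
abbrev ndrOp : NormedDivisionRing ℍᵐᵒᵖ :=
  { (inferInstance : NormedRing ℍᵐᵒᵖ), (inferInstance : DivisionRing ℍᵐᵒᵖ) with
    norm_mul := fun a b => by
      change ‖unop (a * b)‖ = ‖unop a‖ * ‖unop b‖
      rw [unop_mul, _root_.norm_mul, mul_comm] }

/-- The real Hilbert space structure. -/
abbrev realIPS {inn : H → H → ℍ} (hinn : QInner inn) : InnerProductSpace ℝ H :=
  { Module.compHom H (algebraMap ℝ ℍᵐᵒᵖ) with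
    norm_smul_le := fun r x => by
      change ‖op ((algebraMap ℝ ℍ) r) • x‖ ≤ _
      rw [hinn.norm_smul]
      simp
    inner := fun x y => (inn x y).re
    norm_sq_eq_re_inner := fun x => by
      change _ = (inn x x).re
      rw [hinn.norm_sq, Quaternion.re_coe]
    conj_inner_symm := fun x y => by
      change (inn y x).re = (inn x y).re
      rw [hinn.conj_symm y x, Quaternion.re_star]
    add_left := fun x y z => by
      change (inn (x + y) z).re = (inn x z).re + (inn y z).re
      rw [hinn.conj_symm, hinn.add_right, hinn.conj_symm x z, hinn.conj_symm y z]
      simp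
    smul_left := fun x y r => by
      change (inn (op ((algebraMap ℝ ℍ) r) • x) y).re = r * (inn x y).re
      rw [hinn.conj_symm, hinn.smul_right, hinn.conj_symm x y, Quaternion.re_star,
        Quaternion.re_star]
      change (inn y x * (r : ℍ)).re = _
      rw [Quaternion.mul_coe_eq_smul, Quaternion.re_smul, smul_eq_mul] }

lemma QInner.ext_re {inn : H → H → ℍ} (hinn : QInner inn) {a b c d : H}
    (h : ∀ q : ℍ, (inn a (op q • b)).re = (inn c (op q • d)).re) : inn a b = inn c d := by
  refine quat_ext fun q => ?_
  rw [← hinn.smul_right, ← hinn.smul_right]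
  exact h q

end QuatPart

/-- existence and uniqueness of the polar decomposition `T = U₀ |T|` of a
densely defined closed operator `T`, where `Ts = T*`, `TsT = T*T` and `modT = |T|` is the
positive square root of `T*T`. `U₀` is a partial isometry with initial space `N(T)^⊥`
(equivalently `N(U₀) = N(T)`) and final space `closure (R(T))`, and it is unique subject
to `N(U₀) = N(T)`. -/
theorem polar_decomposition_exists_unique
    [CompleteSpace H] (inn : H → H → ℍ) (hinn : QInner inn)
    (T Ts TsT modT : H →ₗ.[ℍᵐᵒᵖ] H)
    (hdense : Dense (T.domain : Set H))
    (hclosed : IsClosed (T.graph : Set (H × H)))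
    (hadj : IsAdjP inn T Ts) (hcomp : IsCompP Ts T TsT)
    (hmodpos : IsPosP inn modT) (hmodsq : IsCompP modT modT TsT) :
    ∃ U₀ : H →L[ℍᵐᵒᵖ] H,
      IsPartialIsomB inn U₀ ∧
      kerB U₀ = pKer T ∧
      Set.range U₀ = closure (pRan T) ∧
      EqCompB T U₀ modT ∧
      ∀ U : H →L[ℍᵐᵒᵖ] H,
        IsPartialIsomB inn U → EqCompB T U modT → kerB U = pKer T → U = U₀ := by
  letI i1 : NormedDivisionRing ℍᵐᵒᵖ := ndrOp
  letI i2 : InnerProductSpace ℝ H := realIPS hinn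
  have hin : ∀ x y : H, inner ℝ x y = (inn x y).re := fun _ _ => rfl
  haveI i3 : IsScalarTower ℝ ℍᵐᵒᵖ H := ⟨fun r q x => by
    change (r • q) • x = (algebraMap ℝ ℍᵐᵒᵖ r) • (q • x)
    rw [Algebra.smul_def, mul_smul]⟩
  haveI i4 : IsBoundedSMul ℍᵐᵒᵖ H := IsBoundedSMul.of_norm_smul_le fun q x =>
    (hinn.norm_smul (unop q) x).le
  have hR : ∀ A B : H →ₗ.[ℍᵐᵒᵖ] H, IsAdjP inn A B → RAdj A B := by
    intro A B h
    refine ⟨fun x y => ?_, fun x z hxz => h.2 x z fun y => hinn.ext_re fun q => ?_⟩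
    · rw [hin, hin, h.1]
    · have := hxz (op q • y)
      rw [LinearPMap.map_smul] at this
      exact this
  have aT := hR _ _ hadj
  have aB := hR _ _ hmodpos.1
  obtain ⟨hBd, hdom, hn⟩ := domains T Ts modT TsT hdense hclosed aT aB hcomp.1 hcomp.2
    hmodsq.1 hmodsq.2
  obtain ⟨U, h1, h2, h3, h4, h5⟩ := polar_real T modT aB hBd hdom hn
  refine ⟨U, fun v hv => h1 v fun y hy => ?_, Set.ext h2, h3, ⟨hdom, h4⟩, ?_⟩
  · rw [hin, hv y hy, Quaternion.re_zero]
  · intro V _ hV hk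
    exact h5 V hV.2 fun v => Set.ext_iff.1 hk v
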